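/- arXiv:1911.04281 — 2 statements merged into one kernel-verified Lean document; each statement's English description precedes it below -/
import Mathlib

section
/- Let G be a linear algebraic group over ℂ acting linearly (rationally) on a finite-dimensional ℂ-vector space W, and let W' ⊆ W be a linear subspace. Then the set G·W' is Zariski dense in W if and only if there exists w ∈ W' such that Lie(G)·w + W' = W. -/
noncomputable section

open MvPolynomial

/-- The Zariski topology on affine `k`-space over `ℂ`, generated by the complements of
hypersurfaces. -/
def zariski (k : ℕ) : TopologicalSpace (Fin k → ℂ) :=
  TopologicalSpace.generateFrom
    {s | ∃ f : MvPolynomial (Fin k) ℂ, s = {x | MvPolynomial.eval x f ≠ 0}}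

/-- The coordinates of a matrix, as a point of affine space. -/
def matCoords {n : ℕ} (M : Matrix (Fin n) (Fin n) ℂ) : Fin n × Fin n → ℂ :=
  fun p => M p.1 p.2

/-- `f` vanishes on the subgroup `G` of `GLₙ(ℂ)`. -/
def vanishesOn {n : ℕ} (G : Subgroup (Matrix.GeneralLinearGroup (Fin n) ℂ))
    (f : MvPolynomial (Fin n × Fin n) ℂ) : Prop :=
  ∀ g ∈ G, MvPolynomial.eval (matCoords (g : Matrix (Fin n) (Fin n) ℂ)) f = 0

/-- `G` is Zariski closed in `GLₙ(ℂ)`: any invertible matrix on which all polynomials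
vanishing on `G` vanish belongs to `G`. -/
def IsZariskiClosedSubgroup {n : ℕ}
    (G : Subgroup (Matrix.GeneralLinearGroup (Fin n) ℂ)) : Prop :=
  ∀ M : Matrix.GeneralLinearGroup (Fin n) ℂ,
    (∀ f : MvPolynomial (Fin n × Fin n) ℂ, vanishesOn G f →
      MvPolynomial.eval (matCoords (M : Matrix (Fin n) (Fin n) ℂ)) f = 0) → M ∈ G

/-- The Lie algebra of `G`: directions `X` at the identity killing all polynomials
vanishing on `G`. -/
def lieAlgOf {n : ℕ} (G : Subgroup (Matrix.GeneralLinearGroup (Fin n) ℂ)) :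
    Set (Matrix (Fin n) (Fin n) ℂ) :=
  {X | ∀ f : MvPolynomial (Fin n × Fin n) ℂ, vanishesOn G f →
    deriv (fun t : ℂ =>
      MvPolynomial.eval (matCoords ((1 : Matrix (Fin n) (Fin n) ℂ) + t • X)) f) 0 = 0}

/-! ### Zariski density -/

lemma zariski_dense_iff {n : ℕ} (S : Set (Fin n → ℂ)) :
    @Dense (Fin n → ℂ) (zariski n) S ↔
      ∀ f : MvPolynomial (Fin n) ℂ, (∀ x ∈ S, MvPolynomial.eval x f = 0) → f = 0 := by
  let _ := zariski n
  have hb : TopologicalSpace.IsTopologicalBasis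
      {s : Set (Fin n → ℂ) | ∃ f : MvPolynomial (Fin n) ℂ,
        s = {x | MvPolynomial.eval x f ≠ 0}} := by
    refine ⟨?_, ?_, rfl⟩
    · rintro _ ⟨f, rfl⟩ _ ⟨g, rfl⟩ x ⟨hf, hg⟩
      refine ⟨_, ⟨f * g, rfl⟩, ?_, ?_⟩
      · simp only [Set.mem_ofPred_eq, map_mul] at *
        exact mul_ne_zero hf hg
      · intro y hy
        simp only [Set.mem_ofPred_eq, map_mul] at hy
        exact ⟨left_ne_zero_of_mul hy, right_ne_zero_of_mul hy⟩
    · refine Set.eq_univ_of_forall fun x => ?_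
      exact ⟨_, ⟨1, rfl⟩, by simp⟩
  rw [hb.dense_iff]
  constructor
  · intro h f hf
    by_contra hne
    have : ∃ x, MvPolynomial.eval x f ≠ 0 := by
      by_contra! hall
      exact hne (MvPolynomial.funext fun x => by simpa using hall x)
    obtain ⟨x, hx, hxS⟩ := h _ ⟨f, rfl⟩ this
    exact hx (hf x hxS)
  · rintro h _ ⟨f, rfl⟩ ⟨x, hx⟩
    by_contra hne
    rw [Set.not_nonempty_iff_eq_empty] at hne
    have : f = 0 := h f fun y hy => by
      by_contra hy0
      have : y ∈ ({x | MvPolynomial.eval x f ≠ 0} ∩ S : Set _) := ⟨hy0, hy⟩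
      rw [hne] at this
      exact this
    simp [this] at hx

/-! ### Directional derivatives of polynomials -/

lemma hasDerivAt_eval {σ : Type*} [Fintype σ] (f : MvPolynomial σ ℂ) (x v : σ → ℂ) :
    HasDerivAt (fun t : ℂ => MvPolynomial.eval (x + t • v) f)
      (∑ i, MvPolynomial.eval x (pderiv i f) * v i) 0 := by
  classical
  induction f using MvPolynomial.induction_on with
  | C a => simpa using hasDerivAt_const (0 : ℂ) a
  | add p q hp hq =>
    have := hp.add hq
    simp only [map_add, add_mul, Finset.sum_add_distrib]
    exact this
  | mul_X p i hp =>
    have hX : HasDerivAt (fun t : ℂ => (x + t • v) i) (v i) 0 := by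
      have := ((hasDerivAt_id (0 : ℂ)).mul_const (v i)).const_add (x i)
      simpa using this
    have := hp.mul hX
    simp only [map_mul, eval_X]
    refine this.congr_deriv ?_
    simp only [pderiv_mul, map_add, map_mul, eval_X, add_mul, Finset.sum_add_distrib, zero_smul,
      add_zero, pderiv_X]
    congr 1
    · rw [Finset.sum_mul]
      exact Finset.sum_congr rfl fun _ _ => by ring
    · rw [Finset.sum_eq_single i]
      · simp
      · intro b _ hb
        simp [hb.symm]
      · simp

lemma dir_eq_zero {σ : Type*} [Fintype σ] (f : MvPolynomial σ ℂ) (x v : σ → ℂ)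
    (h : ∀ t : ℂ, MvPolynomial.eval (x + t • v) f = 0) :
    ∑ i, MvPolynomial.eval x (pderiv i f) * v i = 0 := by
  have h1 := hasDerivAt_eval f x v
  have h2 : (fun t : ℂ => MvPolynomial.eval (x + t • v) f) = fun _ => 0 := funext h
  rw [h2] at h1
  exact h1.unique (hasDerivAt_const _ _)

lemma mem_lieAlgOf_iff {n : ℕ} (G : Subgroup (Matrix.GeneralLinearGroup (Fin n) ℂ))
    (X : Matrix (Fin n) (Fin n) ℂ) :
    X ∈ lieAlgOf G ↔ ∀ f : MvPolynomial (Fin n × Fin n) ℂ, vanishesOn G f →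
      ∑ p, MvPolynomial.eval (matCoords (1 : Matrix (Fin n) (Fin n) ℂ)) (pderiv p f)
        * matCoords X p = 0 := by
  have key : ∀ f : MvPolynomial (Fin n × Fin n) ℂ, deriv (fun t : ℂ =>
      MvPolynomial.eval (matCoords ((1 : Matrix (Fin n) (Fin n) ℂ) + t • X)) f) 0 =
      ∑ p, MvPolynomial.eval (matCoords (1 : Matrix (Fin n) (Fin n) ℂ)) (pderiv p f)
        * matCoords X p := fun f =>
    (hasDerivAt_eval f (matCoords 1) (matCoords X)).deriv
  simp only [lieAlgOf, Set.mem_ofPred_eq, key]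

/-- The Lie algebra as a linear subspace. -/
def lieSub {n : ℕ} (G : Subgroup (Matrix.GeneralLinearGroup (Fin n) ℂ)) :
    Submodule ℂ (Matrix (Fin n) (Fin n) ℂ) where
  carrier := lieAlgOf G
  zero_mem' := by
    rw [mem_lieAlgOf_iff]
    intro f _
    simp [matCoords]
  add_mem' := by
    intro a b ha hb
    rw [mem_lieAlgOf_iff] at *
    intro f hf
    have h1 := ha f hf
    have h2 := hb f hf
    simp only [matCoords, Matrix.add_apply, mul_add, Finset.sum_add_distrib] at *
    rw [h1, h2, add_zero]
  smul_mem' := by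
    intro c a ha
    rw [mem_lieAlgOf_iff] at *
    intro f hf
    have h1 := ha f hf
    simp only [matCoords, Matrix.smul_apply, smul_eq_mul, mul_left_comm _ c,
      ← Finset.mul_sum] at *
    rw [h1, mul_zero]

/-! ### Sufficiency of the infinitesimal condition -/

/-- Substitution `f(w) ↦ f(x * w)` as polynomial in the matrix `x`. -/
lemma eval_orbit {n : ℕ} (f : MvPolynomial (Fin n) ℂ) (w : Fin n → ℂ)
    (M : Matrix (Fin n) (Fin n) ℂ) :
    MvPolynomial.eval (matCoords M)
      (aeval (fun i => ∑ k, X (i, k) * C (w k) : Fin n → MvPolynomial (Fin n × Fin n) ℂ) f) =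
    MvPolynomial.eval (M.mulVec w) f := by
  rw [← MvPolynomial.coe_aeval_eq_eval]
  simp only [RingHom.coe_coe]
  rw [← AlgHom.comp_apply, MvPolynomial.comp_aeval, ← MvPolynomial.coe_aeval_eq_eval]
  simp only [RingHom.coe_coe]
  congr 2
  funext i
  simp [matCoords, Matrix.mulVec, dotProduct]

lemma eval_translate {n : ℕ} (f : MvPolynomial (Fin n) ℂ) (w : Fin n → ℂ)
    (M : Matrix (Fin n) (Fin n) ℂ) :
    MvPolynomial.eval w
      (aeval (fun i => ∑ k, C (M i k) * X k : Fin n → MvPolynomial (Fin n) ℂ) f) =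
    MvPolynomial.eval (M.mulVec w) f := by
  rw [← MvPolynomial.coe_aeval_eq_eval]
  simp only [RingHom.coe_coe]
  rw [← AlgHom.comp_apply, MvPolynomial.comp_aeval, ← MvPolynomial.coe_aeval_eq_eval]
  simp only [RingHom.coe_coe]
  congr 2
  funext i
  simp [Matrix.mulVec, dotProduct]

/-- `f` vanishes on `G·W'`. -/
def vanGW {n : ℕ} (G : Subgroup (Matrix.GeneralLinearGroup (Fin n) ℂ))
    (W' : Submodule ℂ (Fin n → ℂ)) (f : MvPolynomial (Fin n) ℂ) : Prop :=
  ∀ g ∈ G, ∀ w ∈ W', MvPolynomial.eval ((g : Matrix (Fin n) (Fin n) ℂ).mulVec w) f = 0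

lemma vanGW_dir {n : ℕ} {G : Subgroup (Matrix.GeneralLinearGroup (Fin n) ℂ)}
    {W' : Submodule ℂ (Fin n → ℂ)} {f : MvPolynomial (Fin n) ℂ} (hf : vanGW G W' f)
    {w : Fin n → ℂ} (hw : w ∈ W') {X : Matrix (Fin n) (Fin n) ℂ} (hX : X ∈ lieAlgOf G)
    {w' : Fin n → ℂ} (hw' : w' ∈ W') :
    ∑ i, MvPolynomial.eval w (pderiv i f) * (X.mulVec w + w') i = 0 := by
  simp only [Pi.add_apply, mul_add, Finset.sum_add_distrib]
  have h2 : ∑ i, MvPolynomial.eval w (pderiv i f) * w' i = 0 := by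
    apply dir_eq_zero
    intro t
    have := hf 1 G.one_mem (w + t • w') (W'.add_mem hw (W'.smul_mem t hw'))
    simpa using this
  have h1 : ∑ i, MvPolynomial.eval w (pderiv i f) * (X.mulVec w) i = 0 := by
    have h3 := hX (aeval (fun i => ∑ k, MvPolynomial.X (i, k) * C (w k) :
      Fin n → MvPolynomial (Fin n × Fin n) ℂ) f) (fun g hg => by
        rw [eval_orbit]; exact hf g hg w hw)
    simp only [eval_orbit, Matrix.add_mulVec, Matrix.one_mulVec, Matrix.smul_mulVec] at h3
    rw [← h3]
    exact (hasDerivAt_eval f w (X.mulVec w)).deriv.symm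
  rw [h1, h2, add_zero]

lemma vanGW_pderiv_W {n : ℕ} {G : Subgroup (Matrix.GeneralLinearGroup (Fin n) ℂ)}
    {W' : Submodule ℂ (Fin n → ℂ)} {f : MvPolynomial (Fin n) ℂ} (hf : vanGW G W' f)
    {w₀ : Fin n → ℂ} (hw₀ : w₀ ∈ W')
    (h : ∀ v : Fin n → ℂ, ∃ X ∈ lieAlgOf G, ∃ w' ∈ W', X.mulVec w₀ + w' = v)
    {w : Fin n → ℂ} (hw : w ∈ W') (i : Fin n) :
    MvPolynomial.eval w (pderiv i f) = 0 := by
  choose X hX w' hw' hXw using fun j : Fin n => h (Pi.single j 1)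
  let d := w - w₀
  have hd : d ∈ W' := W'.sub_mem hw hw₀
  let M : Matrix (Fin n) (Fin n) (Polynomial ℂ) := fun j k =>
    Polynomial.C ((X j).mulVec w₀ k + w' j k) + Polynomial.X * Polynomial.C ((X j).mulVec d k)
  let φ : Polynomial ℂ := aeval (fun k => Polynomial.C (w₀ k) + Polynomial.X * Polynomial.C (d k))
    (pderiv i f)
  have hφ : ∀ t, φ.eval t = MvPolynomial.eval (w₀ + t • d) (pderiv i f) := by
    intro t
    rw [← MvPolynomial.coe_aeval_eq_eval, ← Polynomial.coe_aeval_eq_eval]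
    simp only [RingHom.coe_coe, φ]
    rw [← AlgHom.restrictScalars_apply ℂ (Polynomial.aeval t), ← AlgHom.comp_apply,
      MvPolynomial.comp_aeval]
    congr 2
    funext k
    simp
    exact mul_comm _ _
  have hM : ∀ t, M.det.eval t = (Matrix.of fun j => (X j).mulVec (w₀ + t • d) + w' j).det := by
    intro t
    rw [← Polynomial.coe_evalRingHom, RingHom.map_det]
    congr 1
    ext j k
    rw [RingHom.mapMatrix_apply, Matrix.map_apply]
    simp only [M, Matrix.mulVec_add, Matrix.mulVec_smul, Polynomial.coe_evalRingHom,
      Polynomial.eval_add, Polynomial.eval_mul, Polynomial.eval_C, Polynomial.eval_X,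
      Matrix.of_apply, Pi.add_apply, Pi.smul_apply, smul_eq_mul]
    ring
  have hprod : M.det * φ = 0 := by
    apply Polynomial.funext
    intro t
    rw [Polynomial.eval_mul, hM, hφ, Polynomial.eval_zero]
    by_cases hdet : (Matrix.of fun j => (X j).mulVec (w₀ + t • d) + w' j).det = 0
    · rw [hdet, zero_mul]
    · have hz : (Matrix.of fun j => (X j).mulVec (w₀ + t • d) + w' j).mulVec
          (fun i => MvPolynomial.eval (w₀ + t • d) (pderiv i f)) = 0 := by
        funext j
        have := vanGW_dir hf (W'.add_mem hw₀ (W'.smul_mem t hd)) (hX j) (hw' j)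
        simp only [Matrix.mulVec, dotProduct, Matrix.of_apply, Pi.zero_apply]
        rw [← this]
        exact Finset.sum_congr rfl fun _ _ => mul_comm _ _
      have := congrFun (Matrix.eq_zero_of_mulVec_eq_zero hdet hz) i
      simp only [Pi.zero_apply] at this
      rw [this, mul_zero]
  have hM0 : M.det ≠ 0 := by
    intro h0
    have := hM 0
    rw [h0] at this
    have h1 : (Matrix.of fun j => (X j).mulVec (w₀ + (0:ℂ) • d) + w' j) = 1 := by
      ext j k
      simp only [zero_smul, add_zero, hXw, Matrix.of_apply, Matrix.one_apply, Pi.single_apply,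
        eq_comm]
    rw [h1] at this
    simp at this
  have hφ0 : φ = 0 := (mul_eq_zero.mp hprod).resolve_left hM0
  have := hφ 1
  rw [hφ0] at this
  simpa [d] using this.symm

lemma vanGW_pderiv {n : ℕ} {G : Subgroup (Matrix.GeneralLinearGroup (Fin n) ℂ)}
    {W' : Submodule ℂ (Fin n → ℂ)} {f : MvPolynomial (Fin n) ℂ} (hf : vanGW G W' f)
    {w₀ : Fin n → ℂ} (hw₀ : w₀ ∈ W')
    (h : ∀ v : Fin n → ℂ, ∃ X ∈ lieAlgOf G, ∃ w' ∈ W', X.mulVec w₀ + w' = v) (i : Fin n) :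
    vanGW G W' (pderiv i f) := by
  intro g hg w hw
  let fg := (aeval (fun i => ∑ k, C ((g : Matrix (Fin n) (Fin n) ℂ) i k) * X k :
    Fin n → MvPolynomial (Fin n) ℂ) f)
  have hfg : vanGW G W' fg := by
    intro g' hg' w hw
    rw [eval_translate, Matrix.mulVec_mulVec]
    exact hf (g * g') (G.mul_mem hg hg') w hw
  let v := ((g⁻¹ : Matrix.GeneralLinearGroup (Fin n) ℂ) : Matrix (Fin n) (Fin n) ℂ).mulVec
    (Pi.single i 1)
  have hv : (g : Matrix (Fin n) (Fin n) ℂ).mulVec v = Pi.single i 1 := by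
    simp only [v, Matrix.mulVec_mulVec]
    rw [← Units.val_mul, mul_inv_cancel, Units.val_one, Matrix.one_mulVec]
  have h1 := hasDerivAt_eval fg w v
  have h2 := hasDerivAt_eval f ((g : Matrix (Fin n) (Fin n) ℂ).mulVec w) (Pi.single i 1)
  have h3 : (fun t : ℂ => MvPolynomial.eval (w + t • v) fg) =
      fun t : ℂ => MvPolynomial.eval ((g : Matrix (Fin n) (Fin n) ℂ).mulVec w +
        t • (Pi.single i 1)) f := by
    funext t
    rw [eval_translate, Matrix.mulVec_add, Matrix.mulVec_smul, hv]
  rw [h3] at h1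
  have h4 := h2.unique h1
  simp only [vanGW_pderiv_W hfg hw₀ h hw, zero_mul, Finset.sum_const_zero] at h4
  rw [Finset.sum_eq_single i] at h4
  · simpa using h4
  · intro b _ hb
    simp [hb]
  · simp

lemma vanGW_eq_zero {n : ℕ} {G : Subgroup (Matrix.GeneralLinearGroup (Fin n) ℂ)}
    {W' : Submodule ℂ (Fin n → ℂ)} {w₀ : Fin n → ℂ} (hw₀ : w₀ ∈ W')
    (h : ∀ v : Fin n → ℂ, ∃ X ∈ lieAlgOf G, ∃ w' ∈ W', X.mulVec w₀ + w' = v)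
    {f : MvPolynomial (Fin n) ℂ} (hf : vanGW G W' f) : f = 0 := by
  ext m
  rw [coeff_zero]
  induction hk : m.degree generalizing m f with
  | zero =>
    have hm : m = 0 := (Finsupp.degree_eq_zero_iff m).mp hk
    subst hm
    have := hf 1 G.one_mem 0 W'.zero_mem
    rw [Matrix.mulVec_zero] at this
    rw [← MvPolynomial.constantCoeff_eq, ← MvPolynomial.eval_zero]
    exact this
  | succ k ih =>
    have hm : m ≠ 0 := by
      rintro rfl
      simp at hk
    obtain ⟨i, hi⟩ := Finsupp.ne_iff.mp hm
    simp only [Finsupp.coe_zero, Pi.zero_apply] at hi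
    have hle : Finsupp.single i 1 ≤ m := by
      rw [Finsupp.single_le_iff]; omega
    obtain ⟨m', rfl⟩ : ∃ m', m = m' + Finsupp.single i 1 :=
      ⟨m - Finsupp.single i 1, (tsub_add_cancel_of_le hle).symm⟩
    have hdeg : m'.degree = k := by
      rw [map_add, Finsupp.degree_single] at hk; omega
    have := ih (vanGW_pderiv hf hw₀ h i) m' hdeg
    rw [coeff_pderiv] at this
    rcases mul_eq_zero.mp this with h0 | h0
    · exact h0
    · exfalso
      exact Nat.cast_add_one_ne_zero _ h0

/-! ### Necessity: lifting derivations to the function field -/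

lemma formallySmooth_of_charZero (K L : Type*) [Field K] [Field L] [CharZero K] [Algebra K L] :
    Algebra.FormallySmooth K L := by
  obtain ⟨s, hs⟩ := exists_isTranscendenceBasis K L
  have := hs.isAlgebraic_field
  exact Algebra.FormallySmooth.of_algebraicIndependent_of_isSeparable hs.1

lemma exists_ringHom_lift {A L B : Type*} [CommRing A] [CommRing L] [CommRing B] [Algebra A L]
    [Algebra.FormallySmooth A L] (π : B →+* L) (hπ : Function.Surjective π)
    (hker : IsNilpotent (RingHom.ker π)) (φ : A →+* B)
    (h : ∀ a, π (φ a) = algebraMap A L a) :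
    ∃ Ψ : L →+* B, (∀ x, π (Ψ x) = x) ∧ ∀ a, Ψ (algebraMap A L a) = φ a := by
  let := φ.toAlgebra
  let π' : B →ₐ[A] L := { π with commutes' := h }
  let Ψ := Algebra.FormallySmooth.liftOfSurjective (AlgHom.id A L) π' hπ hker
  refine ⟨Ψ.toRingHom, fun x => ?_, fun a => Ψ.commutes a⟩
  exact Algebra.FormallySmooth.liftOfSurjective_apply (AlgHom.id A L) π' hπ hker x

lemma exists_dual_lift {L : Type*} [Field L] [Algebra ℂ L] {n : ℕ} (y : Fin n → L)
    (hy : AlgebraicIndependent ℂ y) (d : Fin n → L) :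
    ∃ Ψ : L →ₐ[ℂ] TrivSqZeroExt L L,
      (∀ x, (Ψ x).fst = x) ∧ ∀ j, (Ψ (y j)).snd = d j := by
  let : Algebra (MvPolynomial (Fin n) ℂ) L := (aeval y).toRingHom.toAlgebra
  have hmap : ∀ f : MvPolynomial (Fin n) ℂ,
    algebraMap (MvPolynomial (Fin n) ℂ) L f = aeval y f := fun _ => rfl
  have hinj : Function.Injective (algebraMap (MvPolynomial (Fin n) ℂ) L) := hy
  have : FaithfulSMul (MvPolynomial (Fin n) ℂ) L :=
    (faithfulSMul_iff_algebraMap_injective _ _).mpr hinj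
  let : Algebra (FractionRing (MvPolynomial (Fin n) ℂ)) L :=
    FractionRing.liftAlgebra (MvPolynomial (Fin n) ℂ) L
  have : CharZero (FractionRing (MvPolynomial (Fin n) ℂ)) :=
    charZero_of_injective_algebraMap
      (IsFractionRing.injective (MvPolynomial (Fin n) ℂ) (FractionRing (MvPolynomial (Fin n) ℂ)))
  have := formallySmooth_of_charZero (FractionRing (MvPolynomial (Fin n) ℂ)) L
  have : Algebra.FormallySmooth (MvPolynomial (Fin n) ℂ)
    (FractionRing (MvPolynomial (Fin n) ℂ)) :=
    Algebra.FormallySmooth.of_isLocalization (nonZeroDivisors _)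
  have : Algebra.FormallySmooth (MvPolynomial (Fin n) ℂ) L :=
    Algebra.FormallySmooth.comp _ (FractionRing (MvPolynomial (Fin n) ℂ)) _
  let φ : MvPolynomial (Fin n) ℂ →ₐ[ℂ] TrivSqZeroExt L L :=
    aeval fun j => TrivSqZeroExt.inl (y j) + TrivSqZeroExt.inr (d j)
  obtain ⟨Ψ, h1, h2⟩ := exists_ringHom_lift
    (TrivSqZeroExt.fstHom L L L).toRingHom
    (fun x => ⟨TrivSqZeroExt.inl x, by simp⟩)
    ⟨2, TrivSqZeroExt.kerIdeal_sq L L⟩ φ.toRingHom (by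
      intro f
      rw [hmap]
      have : ((TrivSqZeroExt.fstHom ℂ L L).comp φ) = aeval y := by
        apply MvPolynomial.algHom_ext
        intro j
        simp [φ]
      rw [← this]
      rfl)
  refine ⟨{ Ψ with commutes' := fun c => ?_ }, fun x => h1 x, fun j => ?_⟩
  · have := h2 (C c)
    rw [hmap] at this
    simp only [AlgHom.toRingHom_eq_coe, RingHom.coe_coe,
      MvPolynomial.algHom_C] at this
    exact this
  · have := h2 (X j)
    rw [hmap] at this
    simp only [MvPolynomial.aeval_X, AlgHom.toRingHom_eq_coe, RingHom.coe_coe, φ] at this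
    change (Ψ (y j)).snd = d j
    rw [this]
    simp

/-- A generic point of a set of complex points. -/
lemma exists_generic {σ : Type} {n : ℕ} (S : Set (σ → ℂ)) (Y : Fin n → MvPolynomial σ ℂ)
    (h : ∀ f : MvPolynomial (Fin n) ℂ, (∀ x ∈ S, MvPolynomial.eval x (aeval Y f) = 0) → f = 0) :
    ∃ (L : Type) (_ : Field L) (_ : Algebra ℂ L) (a : σ → L),
      (∀ f : MvPolynomial σ ℂ, (∀ x ∈ S, MvPolynomial.eval x f = 0) → aeval a f = 0) ∧
      AlgebraicIndependent ℂ (fun j => aeval a (Y j)) := by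
  let J : Ideal (MvPolynomial σ ℂ) :=
    { carrier := {f | ∀ x ∈ S, MvPolynomial.eval x f = 0}
      zero_mem' := fun x _ => by simp
      add_mem' := fun {p q} hp hq x hx => by rw [map_add, hp x hx, hq x hx, add_zero]
      smul_mem' := fun c p hp x hx => by rw [smul_eq_mul, map_mul, hp x hx, mul_zero] }
  let T : Submonoid (MvPolynomial σ ℂ) :=
    (nonZeroDivisors (MvPolynomial (Fin n) ℂ)).map (aeval Y : MvPolynomial (Fin n) ℂ →ₐ[ℂ] _)
  have hdis : Disjoint (J : Set (MvPolynomial σ ℂ)) T := by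
    rw [Set.disjoint_left]
    rintro _ hJ ⟨f, hf, rfl⟩
    exact nonZeroDivisors.ne_zero hf (h f hJ)
  obtain ⟨p, hp, hJp, hpT⟩ := J.exists_le_prime_disjoint T hdis
  let q : MvPolynomial σ ℂ →ₐ[ℂ] FractionRing (MvPolynomial σ ℂ ⧸ p) :=
    (IsScalarTower.toAlgHom ℂ (MvPolynomial σ ℂ ⧸ p) _).comp (Ideal.Quotient.mkₐ ℂ p)
  have hq : ∀ f, q f = 0 ↔ f ∈ p := by
    intro f
    have : q f = algebraMap (MvPolynomial σ ℂ ⧸ p) (FractionRing (MvPolynomial σ ℂ ⧸ p))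
      (Ideal.Quotient.mk p f) := rfl
    rw [this, IsFractionRing.to_map_eq_zero_iff, Ideal.Quotient.eq_zero_iff_mem]
  have hqa : ∀ f, aeval (fun s => q (X s)) f = q f := by
    intro f
    exact (AlgHom.congr_fun (MvPolynomial.aeval_unique q) f).symm
  refine ⟨FractionRing (MvPolynomial σ ℂ ⧸ p), inferInstance, inferInstance, fun s => q (X s),
    fun f hf => ?_, ?_⟩
  · rw [hqa, hq]
    exact hJp hf
  · rw [algebraicIndependent_iff]
    intro f hf
    simp only [hqa] at hf
    have h2 : aeval (fun j => q (Y j)) f = q (aeval Y f) := by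
      rw [← AlgHom.comp_apply, MvPolynomial.comp_aeval]
    rw [h2, hq] at hf
    by_contra hne
    exact Set.disjoint_left.mp hpT hf ⟨f, mem_nonZeroDivisors_of_ne_zero hne, rfl⟩

/-- Extension of scalars: a polynomial with coefficients in `E` which vanishes on `S` vanishes
on every `E`-point of the closure of `S`. -/
lemma eval_eq_zero_of_vanish {σ E : Type*} [CommRing E] [Algebra ℂ E] (S : Set (σ → ℂ))
    (a : σ → E)
    (ha : ∀ f : MvPolynomial σ ℂ, (∀ x ∈ S, MvPolynomial.eval x f = 0) → aeval a f = 0)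
    (r : MvPolynomial σ E)
    (hr : ∀ x ∈ S, MvPolynomial.eval (fun s => algebraMap ℂ E (x s)) r = 0) :
    MvPolynomial.eval a r = 0 := by
  classical
  let B := Module.Basis.ofVectorSpace ℂ E
  let R : _ → MvPolynomial σ ℂ := fun b =>
    ∑ m ∈ r.support, monomial m (B.repr (r.coeff m) b)
  have hR : ∀ b, aeval a (R b) = 0 := by
    intro b
    apply ha
    intro x hx
    have h1 := hr x hx
    rw [MvPolynomial.eval_eq] at h1
    have h2 := congrArg (fun z => B.repr z b) h1
    simp only [map_zero, Finsupp.coe_zero, Pi.zero_apply, map_sum, Finsupp.coe_finsetSum,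
      Finset.sum_apply] at h2
    rw [map_sum, ← h2]
    refine Finset.sum_congr rfl fun m _ => ?_
    rw [MvPolynomial.eval_monomial]
    have h3 : r.coeff m * ∏ i ∈ m.support, algebraMap ℂ E (x i) ^ m i =
        (∏ i ∈ m.support, x i ^ m i) • r.coeff m := by
      rw [Algebra.smul_def, map_prod, mul_comm]
      simp only [map_pow]
    rw [h3, map_smul, Finsupp.smul_apply, smul_eq_mul, mul_comm]
    rfl
  let T := r.support.biUnion fun m => (B.repr (r.coeff m)).support
  have hc : ∀ m ∈ r.support, r.coeff m = ∑ b ∈ T, (B.repr (r.coeff m) b) • B b := by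
    intro m hm
    conv_lhs => rw [← B.linearCombination_repr (r.coeff m)]
    rw [Finsupp.linearCombination_apply]
    apply Finsupp.sum_of_support_subset
    · exact Finset.subset_biUnion_of_mem (fun m => (B.repr (r.coeff m)).support) hm
    · simp
  rw [MvPolynomial.eval_eq]
  calc ∑ m ∈ r.support, r.coeff m * ∏ i ∈ m.support, a i ^ m i
      = ∑ m ∈ r.support, ∑ b ∈ T, B b * aeval a (monomial m (B.repr (r.coeff m) b)) := by
        refine Finset.sum_congr rfl fun m hm => ?_
        conv_lhs => rw [hc m hm]
        rw [Finset.sum_mul]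
        refine Finset.sum_congr rfl fun b _ => ?_
        rw [MvPolynomial.aeval_monomial, Algebra.smul_def, Finsupp.prod]
        ring
    _ = ∑ b ∈ T, B b * aeval a (R b) := by
        rw [Finset.sum_comm]
        refine Finset.sum_congr rfl fun b _ => ?_
        rw [map_sum, Finset.mul_sum]
    _ = 0 := by simp [hR]

/-- `E`-valued points of `G`. -/
def IsPt {n : ℕ} (G : Subgroup (Matrix.GeneralLinearGroup (Fin n) ℂ)) {E : Type*} [CommRing E]
    [Algebra ℂ E] (a : Matrix (Fin n) (Fin n) E) : Prop :=
  ∀ f : MvPolynomial (Fin n × Fin n) ℂ, vanishesOn G f → aeval (fun p => a p.1 p.2) f = 0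

lemma IsPt.mul {n : ℕ} {G : Subgroup (Matrix.GeneralLinearGroup (Fin n) ℂ)} {E : Type*}
    [CommRing E] [Algebra ℂ E] {a b : Matrix (Fin n) (Fin n) E} (ha : IsPt G a)
    (hb : IsPt G b) : IsPt G (a * b) := by
  intro f hf
  let r : MvPolynomial (Fin n × Fin n) E :=
    aeval (fun p => ∑ k, X (p.1, k) * C (b k p.2)) f
  have hre : ∀ z : Fin n × Fin n → E, MvPolynomial.eval z r =
      aeval (fun p => ∑ k, z (p.1, k) * b k p.2) f := by
    intro z
    rw [← MvPolynomial.coe_aeval_eq_eval]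
    simp only [RingHom.coe_coe, r]
    rw [← AlgHom.restrictScalars_apply ℂ (MvPolynomial.aeval z), ← AlgHom.comp_apply,
      MvPolynomial.comp_aeval]
    congr 2
    funext p
    simp
  have h1 : aeval (fun p => (a * b) p.1 p.2) f = MvPolynomial.eval (fun p => a p.1 p.2) r := by
    rw [hre]
    rfl
  rw [h1]
  apply eval_eq_zero_of_vanish
    {x | ∃ g ∈ G, x = matCoords ((g : Matrix.GeneralLinearGroup (Fin n) ℂ) : Matrix _ _ ℂ)}
  · intro f hf
    exact ha f fun g hg => hf _ ⟨g, hg, rfl⟩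
  · rintro _ ⟨g, hg, rfl⟩
    rw [hre]
    let f' : MvPolynomial (Fin n × Fin n) ℂ := aeval (fun p : Fin n × Fin n =>
      ∑ k, C ((g : Matrix (Fin n) (Fin n) ℂ) p.1 k) * X (k, p.2)) f
    have hf' : vanishesOn G f' := by
      intro g' hg'
      have := hf (g * g') (G.mul_mem hg hg')
      rw [← this, ← MvPolynomial.coe_aeval_eq_eval, ← MvPolynomial.coe_aeval_eq_eval]
      simp only [RingHom.coe_coe, f']
      rw [← AlgHom.comp_apply, MvPolynomial.comp_aeval]
      congr 2
      funext p
      simp [matCoords, Matrix.mul_apply]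
    have := hb f' hf'
    rw [← this, ← AlgHom.comp_apply, MvPolynomial.comp_aeval]
    congr 2
    funext p
    simp [matCoords]

lemma snd_aeval {σ L : Type*} [Fintype σ] [Field L] [Algebra ℂ L] (c : σ → TrivSqZeroExt L L)
    (f : MvPolynomial σ ℂ) :
    (aeval c f).fst = aeval (fun s => (c s).fst) f ∧
    (aeval c f).snd = ∑ s, aeval (fun s => (c s).fst) (pderiv s f) * (c s).snd := by
  classical
  induction f using MvPolynomial.induction_on with
  | C a =>
    simp only [MvPolynomial.algHom_C, pderiv_C, map_zero, zero_mul, Finset.sum_const_zero]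
    exact ⟨rfl, rfl⟩
  | add p q hp hq =>
    simp only [map_add, TrivSqZeroExt.fst_add, TrivSqZeroExt.snd_add, hp.1, hp.2, hq.1, hq.2,
      add_mul, Finset.sum_add_distrib, and_self]
  | mul_X p i hp =>
    refine ⟨?_, ?_⟩
    · simp [hp.1]
    · simp only [map_mul, aeval_X, TrivSqZeroExt.snd_mul, hp.1, hp.2, pderiv_mul, map_add,
        add_mul, Finset.sum_add_distrib, pderiv_X]
      rw [add_comm]
      congr 1
      · rw [op_smul_eq_mul, Finset.sum_mul]
        exact Finset.sum_congr rfl fun _ _ => by ring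
      · rw [Finset.sum_eq_single i]
        · simp
        · intro b _ hb
          simp [hb.symm]
        · simp

/-- The `L`-points of the Lie algebra are spanned by its complex points. -/
lemma mem_span_lie {n : ℕ} {G : Subgroup (Matrix.GeneralLinearGroup (Fin n) ℂ)} {L : Type*}
    [Field L] [Algebra ℂ L] (Z : Matrix (Fin n) (Fin n) L)
    (hZ : ∀ f : MvPolynomial (Fin n × Fin n) ℂ, vanishesOn G f →
      ∑ p, algebraMap ℂ L (MvPolynomial.eval (matCoords (1 : Matrix (Fin n) (Fin n) ℂ))
        (pderiv p f)) * Z p.1 p.2 = 0) :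
    Z ∈ Submodule.span L (Set.range fun X : lieSub G =>
      (X : Matrix (Fin n) (Fin n) ℂ).map (algebraMap ℂ L)) := by
  classical
  let B := Module.Basis.ofVectorSpace ℂ L
  let Q : _ → Matrix (Fin n) (Fin n) ℂ := fun b => Matrix.of fun i j => B.repr (Z i j) b
  have hQ : ∀ b, Q b ∈ lieSub G := by
    intro b
    change Q b ∈ lieAlgOf G
    rw [mem_lieAlgOf_iff]
    intro f hf
    have h2 := congrArg (fun z => B.repr z b) (hZ f hf)
    simp only [map_zero, Finsupp.coe_zero, Pi.zero_apply, map_sum, Finsupp.coe_finsetSum,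
      Finset.sum_apply, ← Algebra.smul_def, map_smul, Finsupp.smul_apply, smul_eq_mul] at h2
    exact h2
  let T := Finset.univ.biUnion fun p : Fin n × Fin n => (B.repr (Z p.1 p.2)).support
  have hsum : Z = ∑ b ∈ T, B b • (Q b).map (algebraMap ℂ L) := by
    ext i j
    rw [Matrix.sum_apply]
    conv_lhs => rw [← B.linearCombination_repr (Z i j)]
    rw [Finsupp.linearCombination_apply]
    rw [Finsupp.sum_of_support_subset (s := T)]
    · refine Finset.sum_congr rfl fun b _ => ?_
      rw [Algebra.smul_def, mul_comm]
      rfl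
    · exact Finset.subset_biUnion_of_mem
        (fun p : Fin n × Fin n => (B.repr (Z p.1 p.2)).support) (Finset.mem_univ (i, j))
    · simp
  rw [hsum]
  exact Submodule.sum_mem _ fun b _ => Submodule.smul_mem _ _ (Submodule.subset_span ⟨⟨Q b, hQ b⟩, rfl⟩)

/-- The complex points `(g, g⁻¹, u)` used to parametrize `G·W'`. -/
def ptGW {n m : ℕ} (g : Matrix.GeneralLinearGroup (Fin n) ℂ) (u : Fin m → ℂ) :
    (Fin n × Fin n) ⊕ (Fin n × Fin n) ⊕ Fin m → ℂ :=
  Sum.elim (matCoords (g : Matrix (Fin n) (Fin n) ℂ))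
    (Sum.elim (matCoords ((g⁻¹ : Matrix.GeneralLinearGroup (Fin n) ℂ) :
      Matrix (Fin n) (Fin n) ℂ)) u)

/-- The coordinates of `g * (∑ u_l A_l)`. -/
def polGW {n m : ℕ} (A : Fin m → Fin n → ℂ) (i : Fin n) :
    MvPolynomial ((Fin n × Fin n) ⊕ (Fin n × Fin n) ⊕ Fin m) ℂ :=
  ∑ k, X (Sum.inl (i, k)) * ∑ l, C (A l k) * X (Sum.inr (Sum.inr l))

lemma exists_field_span {n m : ℕ} (G : Subgroup (Matrix.GeneralLinearGroup (Fin n) ℂ))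
    (A : Fin m → Fin n → ℂ)
    (hd : ∀ f : MvPolynomial (Fin n) ℂ, (∀ g ∈ G, ∀ u : Fin m → ℂ,
      MvPolynomial.eval ((g : Matrix (Fin n) (Fin n) ℂ).mulVec (∑ l, u l • A l)) f = 0) →
        f = 0) :
    ∃ (L : Type) (_ : Field L) (_ : Algebra ℂ L) (u : Fin m → L),
      ⊤ ≤ Submodule.span L (Set.range (fun X : lieSub G =>
        ((X : Matrix (Fin n) (Fin n) ℂ).map (algebraMap ℂ L)).mulVec
          (fun k => ∑ l, algebraMap ℂ L (A l k) * u l))) ⊔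
        Submodule.span L (Set.range fun l k => algebraMap ℂ L (A l k)) := by
  classical
  obtain ⟨L, _, _, a, ha, hind⟩ := exists_generic
    {x | ∃ g ∈ G, ∃ u : Fin m → ℂ, x = ptGW g u} (polGW A) (by
      intro f hf
      apply hd f
      intro g hg u
      rw [← hf (ptGW g u) ⟨g, hg, u, rfl⟩, ← MvPolynomial.coe_aeval_eq_eval,
        ← MvPolynomial.coe_aeval_eq_eval]
      simp only [RingHom.coe_coe]
      rw [← AlgHom.comp_apply, MvPolynomial.comp_aeval]
      congr 2
      funext i
      simp [polGW, ptGW, matCoords, Matrix.mulVec, dotProduct, Finset.sum_apply, mul_comm])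
  refine ⟨L, inferInstance, inferInstance, fun l => a (Sum.inr (Sum.inr l)), ?_⟩
  let g : Matrix (Fin n) (Fin n) L := Matrix.of fun i j => a (Sum.inl (i, j))
  let g' : Matrix (Fin n) (Fin n) L := Matrix.of fun i j => a (Sum.inr (Sum.inl (i, j)))
  have hg'g : g' * g = 1 := by
    ext i j
    have := ha (∑ k, X (Sum.inr (Sum.inl (i, k))) * X (Sum.inl (k, j)) -
      C ((1 : Matrix (Fin n) (Fin n) ℂ) i j)) (by
        rintro _ ⟨h, hh, u, rfl⟩
        have h1 : (((h⁻¹ : Matrix.GeneralLinearGroup (Fin n) ℂ) : Matrix (Fin n) (Fin n) ℂ) *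
          (h : Matrix (Fin n) (Fin n) ℂ)) i j = (1 : Matrix (Fin n) (Fin n) ℂ) i j := by
          rw [← Units.val_mul, inv_mul_cancel, Units.val_one]
        rw [Matrix.mul_apply] at h1
        simp only [map_sub, map_sum, map_mul, eval_X, eval_C, ptGW, Sum.elim_inr, Sum.elim_inl,
          matCoords]
        rw [h1, sub_self])
    simp only [map_sub, map_sum, map_mul, aeval_X, algHom_C, sub_eq_zero] at this
    rw [Matrix.mul_apply]
    simp only [g, g', Matrix.of_apply]
    rw [this, Matrix.one_apply, Matrix.one_apply]
    split_ifs <;> simp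
  set V := Submodule.span L (Set.range (fun X : lieSub G =>
        ((X : Matrix (Fin n) (Fin n) ℂ).map (algebraMap ℂ L)).mulVec
          (fun k => ∑ l, algebraMap ℂ L (A l k) * a (Sum.inr (Sum.inr l))))) ⊔
        Submodule.span L (Set.range fun l k => algebraMap ℂ L (A l k)) with hV
  have hcol : ∀ i₀, (fun j => g' j i₀) ∈ V := by
    intro i₀
    obtain ⟨Ψ, hΨ1, hΨ2⟩ := exists_dual_lift _ hind (Pi.single i₀ 1)
    let gt : Matrix (Fin n) (Fin n) (TrivSqZeroExt L L) :=
      Matrix.of fun i j => Ψ (a (Sum.inl (i, j)))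
    let gt' : Matrix (Fin n) (Fin n) (TrivSqZeroExt L L) :=
      Matrix.of fun i j => TrivSqZeroExt.inl (g' i j)
    let wt : Fin n → TrivSqZeroExt L L := fun k =>
      ∑ l, algebraMap ℂ _ (A l k) * Ψ (a (Sum.inr (Sum.inr l)))
    have hgt : IsPt G gt := by
      intro f hf
      have := ha (rename Sum.inl f) (by
        rintro _ ⟨h, hh, u, rfl⟩
        rw [MvPolynomial.eval_rename]
        exact hf h hh)
      rw [MvPolynomial.aeval_rename] at this
      have h2 := congrArg Ψ this
      rw [map_zero, ← AlgHom.comp_apply, MvPolynomial.comp_aeval] at h2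
      exact h2
    have hgt' : IsPt G gt' := by
      intro f hf
      have := ha (rename (Sum.inr ∘ Sum.inl) f) (by
        rintro _ ⟨h, hh, u, rfl⟩
        rw [MvPolynomial.eval_rename]
        exact hf h⁻¹ (G.inv_mem hh))
      rw [MvPolynomial.aeval_rename] at this
      have h2 := congrArg (TrivSqZeroExt.inlAlgHom ℂ L L) this
      rw [map_zero, ← AlgHom.comp_apply, MvPolynomial.comp_aeval] at h2
      exact h2
    have hc := hgt'.mul hgt
    have hfst : ∀ i j, ((gt' * gt) i j).fst = (1 : Matrix (Fin n) (Fin n) L) i j := by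
      intro i j
      rw [← hg'g, Matrix.mul_apply, Matrix.mul_apply, TrivSqZeroExt.fst_sum]
      refine Finset.sum_congr rfl fun k _ => ?_
      rw [TrivSqZeroExt.fst_mul]
      simp [gt, gt', g, hΨ1]
    let Z : Matrix (Fin n) (Fin n) L := Matrix.of fun i j => ((gt' * gt) i j).snd
    have hZ := mem_span_lie (G := G) Z (by
      intro f hf
      have h1 := (snd_aeval (fun p : Fin n × Fin n => (gt' * gt) p.1 p.2) f).2
      rw [hc f hf] at h1
      rw [TrivSqZeroExt.snd_zero] at h1
      rw [h1]
      refine Finset.sum_congr rfl fun p _ => ?_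
      simp only [hfst]
      congr 1
      rw [← MvPolynomial.coe_aeval_eq_eval]
      simp only [RingHom.coe_coe]
      rw [← Algebra.ofId_apply, ← AlgHom.comp_apply, MvPolynomial.comp_aeval]
      congr 2
      funext q
      simp only [matCoords, Matrix.one_apply]
      split_ifs <;> simp)
    have hwt1 : ∀ k, (wt k).fst = ∑ l, algebraMap ℂ L (A l k) * a (Sum.inr (Sum.inr l)) := by
      intro k
      simp only [wt, TrivSqZeroExt.fst_sum, TrivSqZeroExt.fst_mul, hΨ1]
      rfl
    have hwt2 : ∀ k, (wt k).snd = ∑ l, algebraMap ℂ L (A l k) *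
        (Ψ (a (Sum.inr (Sum.inr l)))).snd := by
      intro k
      simp only [wt, TrivSqZeroExt.snd_sum]
      refine Finset.sum_congr rfl fun l _ => ?_
      rw [← Algebra.smul_def, TrivSqZeroExt.snd_smul, Algebra.smul_def]
    have hyt : gt.mulVec wt = fun i => Ψ (aeval a (polGW A i)) := by
      funext i
      simp only [polGW, map_sum, map_mul, aeval_X, algHom_C, AlgHom.commutes, gt, wt,
        Matrix.mulVec, dotProduct, Matrix.of_apply]
    have heq : (gt' * gt).mulVec wt = gt'.mulVec fun i => Ψ (aeval a (polGW A i)) := by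
      rw [← Matrix.mulVec_mulVec, hyt]
    have hmain : (fun j => g' j i₀) = Z.mulVec (fun k => ∑ l, algebraMap ℂ L (A l k) *
        a (Sum.inr (Sum.inr l))) + ∑ l, (Ψ (a (Sum.inr (Sum.inr l)))).snd •
          (fun k => algebraMap ℂ L (A l k)) := by
      funext j
      have h1 := congrArg TrivSqZeroExt.snd (congrFun heq j)
      have f1 : ∀ i j, (gt' i j).fst = g' i j := fun _ _ => rfl
      have f2 : ∀ i j, (gt' i j).snd = 0 := fun _ _ => rfl
      simp only [Matrix.mulVec, dotProduct, TrivSqZeroExt.snd_sum, TrivSqZeroExt.snd_mul, hfst,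
        hΨ2, hΨ1, op_smul_eq_mul, smul_eq_mul, f1, f2, zero_mul, add_zero,
        Finset.sum_add_distrib] at h1
      have e1 : ∑ x, (1 : Matrix (Fin n) (Fin n) L) j x * (wt x).snd = (wt j).snd := by
        simp [Matrix.one_apply]
      have e2 : ∑ i, g' j i * (Pi.single i₀ 1 : Fin n → L) i = g' j i₀ := by
        simp [Pi.single_apply]
      rw [e1, e2, hwt2] at h1
      rw [← h1, add_comm]
      simp only [Pi.add_apply, Matrix.mulVec, dotProduct, Finset.sum_apply, Pi.smul_apply,
        smul_eq_mul, Z, Matrix.of_apply, hwt1]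
      congr 1
      exact Finset.sum_congr rfl fun _ _ => mul_comm _ _
    clear_value Z
    rw [hmain]
    refine V.add_mem (Submodule.mem_sup_left ?_) (Submodule.mem_sup_right ?_)
    · clear hmain
      induction hZ using Submodule.span_induction with
      | mem x hx =>
        obtain ⟨X, rfl⟩ := hx
        exact Submodule.subset_span ⟨X, rfl⟩
      | zero => rw [Matrix.zero_mulVec]; exact Submodule.zero_mem _
      | add x y _ _ hx hy => rw [Matrix.add_mulVec]; exact Submodule.add_mem _ hx hy
      | smul c x _ hx => rw [Matrix.smul_mulVec]; exact Submodule.smul_mem _ _ hx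
    · exact Submodule.sum_mem _ fun l _ => Submodule.smul_mem _ _ (Submodule.subset_span ⟨l, rfl⟩)
  intro v _
  have hv : v = ∑ i, (g.mulVec v) i • (fun j => g' j i) := by
    conv_lhs => rw [← Matrix.one_mulVec v, ← hg'g, ← Matrix.mulVec_mulVec]
    funext j
    simp only [Matrix.mulVec, dotProduct, Finset.sum_apply, Pi.smul_apply, smul_eq_mul]
    exact Finset.sum_congr rfl fun _ _ => mul_comm _ _
  rw [hv]
  exact V.sum_mem fun i _ => V.smul_mem _ (hcol i)

/-- If polynomial vectors span at some point over an extension field, they span at some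
complex point. -/
lemma exists_complex_span {n m : ℕ} {ι : Type*} (ν : ι → Fin n → MvPolynomial (Fin m) ℂ)
    {L : Type*} [Field L] [Algebra ℂ L] (u : Fin m → L)
    (h : ⊤ ≤ Submodule.span L (Set.range fun k j => aeval u (ν k j))) :
    ∃ u₀ : Fin m → ℂ,
      ⊤ ≤ Submodule.span ℂ (Set.range fun k j => MvPolynomial.eval u₀ (ν k j)) := by
  classical
  obtain ⟨κ, e, -, hsp, hli⟩ := exists_linearIndependent' L (fun k j => aeval u (ν k j))
  let b : Module.Basis κ L (Fin n → L) := Module.Basis.mk hli (by rw [hsp]; exact h)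
  let ε : κ ≃ Fin n := b.indexEquiv (Pi.basisFun L (Fin n))
  let M : Matrix (Fin n) (Fin n) (MvPolynomial (Fin m) ℂ) := Matrix.of fun i j => ν (e (ε.symm i)) j
  have hM : aeval u M.det ≠ 0 := by
    rw [AlgHom.map_det]
    have h1 : LinearIndependent L ((aeval u).mapMatrix M).row := by
      exact hli.comp ε.symm ε.symm.injective
    rw [Matrix.linearIndependent_rows_iff_isUnit, Matrix.isUnit_iff_isUnit_det] at h1
    exact h1.ne_zero
  have hM0 : M.det ≠ 0 := by
    intro h0
    rw [h0, map_zero] at hM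
    exact hM rfl
  have : ∃ u₀, MvPolynomial.eval u₀ M.det ≠ 0 := by
    by_contra! hall
    exact hM0 (MvPolynomial.funext fun x => by simpa using hall x)
  obtain ⟨u₀, hu₀⟩ := this
  refine ⟨u₀, ?_⟩
  rw [RingHom.map_det] at hu₀
  have h2 : LinearIndependent ℂ ((MvPolynomial.eval u₀).mapMatrix M).row := by
    rw [Matrix.linearIndependent_rows_iff_isUnit, Matrix.isUnit_iff_isUnit_det]
    exact isUnit_iff_ne_zero.mpr hu₀
  have h3 := h2.span_eq_top_of_card_eq_finrank' (by simp)
  rw [← h3]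
  apply Submodule.span_mono
  rintro _ ⟨i, rfl⟩
  exact ⟨e (ε.symm i), rfl⟩

lemma exists_good_of_dense {n : ℕ} (G : Subgroup (Matrix.GeneralLinearGroup (Fin n) ℂ))
    (W' : Submodule ℂ (Fin n → ℂ))
    (hd : ∀ f : MvPolynomial (Fin n) ℂ, vanGW G W' f → f = 0) :
    ∃ w ∈ W', ∀ v : Fin n → ℂ,
        ∃ X ∈ lieAlgOf G, ∃ w' ∈ W', X.mulVec w + w' = v := by
  classical
  let b := Module.finBasis ℂ W'
  let A : Fin (Module.finrank ℂ W') → Fin n → ℂ := fun l => (b l : Fin n → ℂ)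
  have hA : ∀ u : Fin (Module.finrank ℂ W') → ℂ, ∑ l, u l • A l ∈ W' := fun u =>
    W'.sum_mem fun l _ => W'.smul_mem _ (b l).2
  obtain ⟨L, _, _, u, hu⟩ := exists_field_span G A (by
    intro f hf
    apply hd
    intro g hg w hw
    have h1 : w = ∑ l, b.repr ⟨w, hw⟩ l • A l := by
      have := congrArg (Submodule.subtype W') (b.sum_repr ⟨w, hw⟩)
      rw [map_sum] at this
      exact this.symm
    rw [h1]
    exact hf g hg _)
  let ν : lieSub G ⊕ Fin (Module.finrank ℂ W') → Fin n →
      MvPolynomial (Fin (Module.finrank ℂ W')) ℂ :=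
    Sum.elim (fun X j => ∑ k, C ((X : Matrix (Fin n) (Fin n) ℂ) j k) * ∑ l, C (A l k) * MvPolynomial.X l)
      (fun l j => C (A l j))
  obtain ⟨u₀, hu₀⟩ := exists_complex_span ν u (by
    rw [← Submodule.span_union] at hu
    refine hu.trans (Submodule.span_mono ?_)
    rintro _ (⟨X, rfl⟩ | ⟨l, rfl⟩)
    · refine ⟨Sum.inl X, ?_⟩
      funext j
      simp [ν, Matrix.mulVec, dotProduct, MvPolynomial.algHom_C]
    · refine ⟨Sum.inr l, ?_⟩
      funext j
      simp [ν, MvPolynomial.algHom_C])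
  refine ⟨_, hA u₀, fun v => ?_⟩
  have hle : Submodule.span ℂ (Set.range fun k j => MvPolynomial.eval u₀ (ν k j)) ≤
      (lieSub G).map ((Matrix.mulVecBilin ℂ ℂ).flip (∑ l, u₀ l • A l)) ⊔ W' := by
    rw [Submodule.span_le]
    rintro _ ⟨X | l, rfl⟩
    · refine Submodule.mem_sup_left ⟨X, X.2, ?_⟩
      funext j
      have : ∀ k, (∑ l, u₀ l • A l) k = ∑ l, A l k * u₀ l := fun k => by
        rw [Finset.sum_apply]
        exact Finset.sum_congr rfl fun _ _ => mul_comm _ _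
      change ((X : Matrix (Fin n) (Fin n) ℂ).mulVec (∑ l, u₀ l • A l)) j =
        MvPolynomial.eval u₀ (ν (Sum.inl X) j)
      simp only [ν, Sum.elim_inl, map_sum, map_mul, eval_C, eval_X, ← this]
      rfl
    · refine Submodule.mem_sup_right ?_
      have : (fun j => MvPolynomial.eval u₀ (ν (Sum.inr l) j)) = A l := by
        funext j
        simp [ν]
      change (fun j => MvPolynomial.eval u₀ (ν (Sum.inr l) j)) ∈ W'
      rw [this]
      exact (b l).2
  obtain ⟨_, ⟨X, hX, rfl⟩, w', hw', hv⟩ := Submodule.mem_sup.mp (hle (hu₀ (Submodule.mem_top (x := v))))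
  exact ⟨X, hX, w', hw', hv⟩

/-- For a linear algebraic group `G` acting linearly on a finite-dimensional `ℂ`-vector
space `W` and a subspace `W' ⊆ W`, the set `G·W'` is Zariski dense in `W` iff there is
`w ∈ W'` with `Lie(G)·w + W' = W`. -/
theorem stmt2 (n : ℕ) (G : Subgroup (Matrix.GeneralLinearGroup (Fin n) ℂ))
    (hG : IsZariskiClosedSubgroup G) (W' : Submodule ℂ (Fin n → ℂ)) :
    (@Dense (Fin n → ℂ) (zariski n)
        {x | ∃ g ∈ G, ∃ w ∈ W', (g : Matrix (Fin n) (Fin n) ℂ).mulVec w = x}) ↔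
      ∃ w ∈ W', ∀ v : Fin n → ℂ,
        ∃ X ∈ lieAlgOf G, ∃ w' ∈ W', X.mulVec w + w' = v := by
  rw [zariski_dense_iff]
  constructor
  · intro h
    refine exists_good_of_dense G W' fun f hf => h f ?_
    rintro _ ⟨g, hg, w, hw, rfl⟩
    exact hf g hg w hw
  · rintro ⟨w, hw, h⟩ f hf
    exact vanGW_eq_zero hw h fun g hg w' hw' => hf _ ⟨g, hg, w', hw', rfl⟩


end
end

section
/- Let m = Σ_{i∈I} Δ_i and m' = Σ_{i'∈I'} Δ_{i'} be multisegments over ℤ (finite families of integer intervals) with I ∩ I' = ∅, and suppose that for all i ∈ I, i' ∈ I' we have σ⁻¹Δ_i ⊀ Δ_{i'} (i.e., it is not the case that b(Δ_{i'}) ∈ Δ_i and e(Δ_i) ∈ Δ_{i'}). Suppose for each i ∈ I ∪ I' we are given a partition Δ_i = A_i ∪ B_i with every element of A_i strictly less than every element of B_i, such that the multiset union of the B_i for i ∈ I equals (with multiplicity, as multisets of integers) the multiset union of the A_{i'} for i' ∈ I'. Then B_i = ∅ for all i ∈ I and A_{i'} = ∅ for all i' ∈ I'. -/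
/-- Precedence of segments over `ℤ`. -/
def SegPrec (a b a' b' : ℤ) : Prop := a < a' ∧ a' ≤ b + 1 ∧ b < b'

/-- Lemma on partitions of multisegments: if `σ⁻¹Δ_i ⊀ Δ_{i'}` for all `i ∈ I, i' ∈ I'`,
and each segment is partitioned as `Δ = A ∪ B` with `A < B` elementwise, and the multiset
union of the `B_i` (`i ∈ I`) equals the multiset union of the `A_{i'}` (`i' ∈ I'`), then
all `B_i` and all `A_{i'}` are empty. -/
theorem stmt8 {ι ι' : Type} [Fintype ι] [Fintype ι']
    (a b : ι → ℤ) (hab : ∀ i, a i ≤ b i)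
    (a' b' : ι' → ℤ) (hab' : ∀ i', a' i' ≤ b' i')
    (hnp : ∀ i i', ¬ SegPrec (a i - 1) (b i - 1) (a' i') (b' i'))
    (A B : ι → Finset ℤ) (A' B' : ι' → Finset ℤ)
    (hpart : ∀ i, A i ∪ B i = Finset.Icc (a i) (b i))
    (hdisj : ∀ i, Disjoint (A i) (B i))
    (hlt : ∀ i, ∀ x ∈ A i, ∀ y ∈ B i, x < y)
    (hpart' : ∀ i', A' i' ∪ B' i' = Finset.Icc (a' i') (b' i'))
    (hdisj' : ∀ i', Disjoint (A' i') (B' i'))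
    (hlt' : ∀ i', ∀ x ∈ A' i', ∀ y ∈ B' i', x < y)
    (hmult : (∑ i : ι, (B i).val) = ∑ i' : ι', (A' i').val) :
    (∀ i, B i = ∅) ∧ (∀ i', A' i' = ∅) := by
  have hmem : ∀ x, (∃ i, x ∈ B i) ↔ ∃ i', x ∈ A' i' := by
    intro x
    have h : x ∈ (∑ i : ι, (B i).val) ↔ x ∈ ∑ i' : ι', (A' i').val := by rw [hmult]
    simpa [Multiset.mem_sum] using h
  have key : ∀ x i', x ∉ A' i' := by
    intro x i' hx
    have hne : (Finset.univ.biUnion A').Nonempty := ⟨x, by simpa using ⟨i', hx⟩⟩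
    obtain ⟨M, hM, hmax⟩ := Finset.exists_max_image _ (fun z : ℤ => z) hne
    obtain ⟨k, hk⟩ : ∃ k, M ∈ A' k := by simpa using hM
    have hMk : M ∈ Finset.Icc (a' k) (b' k) := by
      rw [← hpart' k]; exact Finset.mem_union_left _ hk
    rw [Finset.mem_Icc] at hMk
    have hak : a' k ∈ A' k := by
      have h : a' k ∈ A' k ∪ B' k := by
        rw [hpart' k]; exact Finset.mem_Icc.2 ⟨le_refl _, hab' k⟩
      rcases Finset.mem_union.1 h with h | h
      · exact h
      · have := hlt' k M hk _ h
        omega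
    obtain ⟨j, hj⟩ := (hmem _).2 ⟨k, hak⟩
    have hjI : a' k ∈ Finset.Icc (a j) (b j) := by
      rw [← hpart j]; exact Finset.mem_union_right _ hj
    rw [Finset.mem_Icc] at hjI
    have hbj : b j ∈ B j := by
      have h : b j ∈ A j ∪ B j := by
        rw [hpart j]; exact Finset.mem_Icc.2 ⟨hab j, le_refl _⟩
      rcases Finset.mem_union.1 h with h | h
      · have := hlt j _ h _ hj
        omega
      · exact h
    have hle : b j ≤ M := hmax (b j) (by simpa using (hmem _).1 ⟨j, hbj⟩)
    exact hnp j k ⟨by omega, by omega, by omega⟩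
  refine ⟨fun i => Finset.eq_empty_of_forall_notMem fun x hx => ?_,
    fun i' => Finset.eq_empty_of_forall_notMem fun x => key x i'⟩
  obtain ⟨k, hk⟩ := (hmem x).1 ⟨i, hx⟩
  exact key x k hk
end
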